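/- Let p be an odd prime. Then the real numbers cot(πk/p) for k = 1, …, (p−1)/2 are linearly independent over ℚ: if a_1, …, a_{(p−1)/2} are rational numbers with Σ_{k=1}^{(p−1)/2} a_k · cot(πk/p) = 0, then all a_k = 0. -/

import Mathlib

open Filter Topology in
/-- Euler's partial fraction expansion of the cotangent, as a sum over `ℕ`. -/
theorem tendsto_sum_range_pi_mul_cot {a : ℝ} (ha : a ∈ Set.Ioo 0 1) :
    Tendsto (fun N : ℕ ↦ ∑ n ∈ Finset.range N, (1 / (n + a : ℂ) - 1 / (n + 1 - a : ℂ)))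
      atTop (𝓝 (Real.pi * Complex.cot (Real.pi * a))) := by
  have hmem : (a : ℂ) ∈ Complex.integerComplement := by
    rintro ⟨n, hn⟩
    have hn' : (n : ℝ) = a := by exact_mod_cast hn
    have h0 : (0 : ℝ) < n := hn' ▸ ha.1
    have h1 : (n : ℝ) < 1 := hn' ▸ ha.2
    norm_cast at h0 h1
    omega
  have hlim : Tendsto (fun N : ℕ ↦ (1 : ℂ) / (N + a)) atTop (𝓝 0) := by
    have h : Tendsto (fun N : ℕ ↦ (1 : ℝ) / (N + a)) atTop (𝓝 0) :=
      tendsto_const_nhds.div_atTop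
        (tendsto_atTop_add_const_right _ _ tendsto_natCast_atTop_atTop)
    simpa [Function.comp_def] using (Complex.continuous_ofReal.tendsto 0).comp h
  have hcot := ((tendsto_logDeriv_euler_cot_sub hmem).add_const (1 / (a : ℂ))).sub hlim
  rw [sub_add_cancel, sub_zero] at hcot
  refine hcot.congr fun N ↦ ?_
  induction N with
  | zero => simp
  | succ N ih =>
    rw [Finset.sum_range_succ, Finset.sum_range_succ, ← ih, cotTerm]
    have h : (1 : ℂ) / (N + 1 - a) = - (1 / (a - (N + 1))) := by
      rw [← neg_sub, one_div_neg_eq_neg_one_div]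
    rw [h]
    push_cast
    rw [add_comm (a : ℂ) (N + 1)]
    ring

/-- A bound, uniform in `s ∈ [1, 2]`, for the variation of `x ^ (-s)` on `[m, m + 1]`. -/
theorem abs_one_div_rpow_sub_le {m x y s : ℝ} (hm : 1 ≤ m) (hx : x ∈ Set.Icc m (m + 1))
    (hy : y ∈ Set.Icc m (m + 1)) (hs : s ∈ Set.Icc 1 2) :
    |1 / x ^ s - 1 / y ^ s| ≤ 2 / m ^ 2 := by
  have hm0 : 0 < m := by linarith
  have key {z : ℝ} (hz : z ∈ Set.Icc m (m + 1)) :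
      1 / (m + 1) ^ s ≤ 1 / z ^ s ∧ 1 / z ^ s ≤ 1 / m ^ s := by
    have hz0 : 0 < z := hm0.trans_le hz.1
    have hs0 : 0 ≤ s := by linarith [hs.1]
    exact ⟨one_div_le_one_div_of_le (by positivity) (Real.rpow_le_rpow hz0.le hz.2 hs0),
      one_div_le_one_div_of_le (by positivity) (Real.rpow_le_rpow hm0.le hz.1 hs0)⟩
  have hmain : 1 / m ^ s - 1 / (m + 1) ^ s ≤ 2 / m ^ 2 := by
    have h1 : 1 / m ^ s ≤ 1 / m := by
      refine one_div_le_one_div_of_le hm0 ?_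
      simpa using Real.rpow_le_rpow_of_exponent_le hm hs.1
    have h2 : (m / (m + 1)) ^ 2 ≤ (m / (m + 1)) ^ s := by
      have := Real.rpow_le_rpow_of_exponent_ge (x := m / (m + 1)) (by positivity)
        ((div_le_one (by positivity)).2 (by linarith)) hs.2
      simpa using this
    have h3 : 1 / m ^ s - 1 / (m + 1) ^ s = 1 / m ^ s * (1 - (m / (m + 1)) ^ s) := by
      rw [Real.div_rpow hm0.le (by positivity)]
      have : 0 < m ^ s := by positivity
      field_simp
    have h4 : 1 / m * (1 - (m / (m + 1)) ^ 2) ≤ 2 / m ^ 2 := by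
      rw [← sub_nonneg]
      have : 2 / m ^ 2 - 1 / m * (1 - (m / (m + 1)) ^ 2) = (3 * m + 2) / (m ^ 2 * (m + 1) ^ 2) := by
        field_simp
        ring
      rw [this]
      positivity
    have h5 : (m / (m + 1)) ^ 2 ≤ 1 := pow_le_one₀ (by positivity)
      ((div_le_one (by positivity)).2 (by linarith))
    rw [h3]
    refine le_trans ?_ h4
    have : 0 < 1 / m := by positivity
    nlinarith [mul_le_mul_of_nonneg_left h2 (by positivity : 0 ≤ 1 / m ^ s)]
  rw [abs_le]
  have hkx := key hx
  have hky := key hy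
  constructor <;> linarith [hkx.1, hkx.2, hky.1, hky.2]

open Filter Topology in
/-- The value at `1` of the odd Hurwitz zeta function. -/
theorem HurwitzZeta.hurwitzZetaOdd_one_of_mem_Ioo {a : ℝ} (ha : a ∈ Set.Ioo 0 1) :
    hurwitzZetaOdd a 1 = Real.pi / 2 * Complex.cot (Real.pi * a) := by
  obtain ⟨ha0, ha1⟩ := ha
  have ha1' : 0 < 1 - a := sub_pos.2 ha1
  let f (s : ℝ) (n : ℕ) : ℝ := 1 / (n + a) ^ s - 1 / (n + 1 - a) ^ s
  let bound (n : ℕ) : ℝ := (if n = 0 then 1 / a ^ 2 + 1 / (1 - a) ^ 2 else 0) + 2 / (n : ℝ) ^ 2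
  have hpos (n : ℕ) : 0 < n + a ∧ 0 < n + 1 - a :=
    ⟨by positivity, by rw [add_sub_assoc]; positivity⟩
  have hbound_summable : Summable bound := by
    refine (hasSum_ite_eq 0 _).summable.add ?_
    simpa [div_eq_mul_inv] using (Real.summable_nat_pow_inv.2 one_lt_two).mul_left (2 : ℝ)
  have hbound {s : ℝ} (hs : s ∈ Set.Icc 1 2) (n : ℕ) : |f s n| ≤ bound n := by
    rcases Nat.eq_zero_or_pos n with rfl | hn
    · have key {x : ℝ} (hx0 : 0 < x) (hx1 : x ≤ 1) : 1 / x ^ s ≤ 1 / x ^ 2 := by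
        refine one_div_le_one_div_of_le (by positivity) ?_
        simpa using Real.rpow_le_rpow_of_exponent_ge hx0 hx1 hs.2
      have h1 := key ha0 ha1.le
      have h2 := key ha1' (by linarith)
      have h3 : 0 < 1 / a ^ s := by positivity
      have h4 : 0 < 1 / (1 - a) ^ s := by positivity
      simp only [f, bound, Nat.cast_zero, zero_add, if_true]
      rw [abs_le]
      norm_num only [add_zero]
      constructor <;> linarith
    · have h := abs_one_div_rpow_sub_le (m := n) (x := n + a) (y := n + 1 - a) (s := s)
        (by exact_mod_cast hn) ⟨by linarith, by linarith⟩ ⟨by linarith, by linarith⟩ hs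
      simpa [f, bound, hn.ne'] using h
  have hcast (s : ℝ) (n : ℕ) : ((f s n : ℝ) : ℂ) =
      1 / (n + a : ℂ) ^ (s : ℂ) - 1 / (n + 1 - a : ℂ) ^ (s : ℂ) := by
    simp only [f]
    push_cast
    rw [Complex.ofReal_cpow (hpos n).1.le, Complex.ofReal_cpow (hpos n).2.le]
    push_cast
    rfl
  have htsum : ∑' n, ((f 1 n : ℝ) : ℂ) = Real.pi * Complex.cot (Real.pi * a) := by
    have hsum : Summable fun n ↦ ((f 1 n : ℝ) : ℂ) :=
      .of_norm_bounded hbound_summable fun n ↦ by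
        simpa using hbound ⟨le_rfl, one_le_two⟩ n
    refine tendsto_nhds_unique hsum.hasSum.tendsto_sum_nat ?_
    simpa [hcast] using tendsto_sum_range_pi_mul_cot ⟨ha0, ha1⟩
  have hlim : Tendsto (fun s : ℝ ↦ ∑' n, ((f s n : ℝ) : ℂ)) (𝓝[>] 1)
      (𝓝 (∑' n, ((f 1 n : ℝ) : ℂ))) := by
    refine tendsto_tsum_of_dominated_convergence hbound_summable (fun n ↦ ?_) ?_
    · refine (Complex.continuous_ofReal.tendsto _).comp (tendsto_nhdsWithin_of_tendsto_nhds ?_)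
      have h (x : ℝ) (hx : 0 < x) : Tendsto (fun s : ℝ ↦ 1 / x ^ s) (𝓝 1) (𝓝 (1 / x ^ (1 : ℝ))) :=
        tendsto_const_nhds.div (Real.continuousAt_const_rpow hx.ne') (by positivity)
      exact (h _ (hpos n).1).sub (h _ (hpos n).2)
    · filter_upwards [Ioo_mem_nhdsGT (one_lt_two (α := ℝ))] with s hs n
      simpa using hbound ⟨hs.1.le, hs.2.le⟩ n
  have hzeta : Tendsto (fun s : ℝ ↦ 2 * hurwitzZetaOdd a s) (𝓝[>] 1)
      (𝓝 (2 * hurwitzZetaOdd a 1)) := by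
    have hc : Continuous fun s : ℝ ↦ 2 * hurwitzZetaOdd a s :=
      continuous_const.mul
        ((differentiable_hurwitzZetaOdd a).continuous.comp Complex.continuous_ofReal)
    simpa using (hc.tendsto 1).mono_left nhdsWithin_le_nhds
  have heq : (fun s : ℝ ↦ 2 * hurwitzZetaOdd a s) =ᶠ[𝓝[>] 1]
      fun s : ℝ ↦ ∑' n, ((f s n : ℝ) : ℂ) := by
    filter_upwards [self_mem_nhdsWithin] with s hs
    have h := (hasSum_nat_hurwitzZetaOdd_of_mem_Icc (a := a) ⟨ha0.le, ha1.le⟩ (s := s)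
      (by simpa using hs)).mul_left 2
    rw [← h.tsum_eq]
    refine tsum_congr fun n ↦ ?_
    rw [hcast]
    ring
  have h := tendsto_nhds_unique (hzeta.congr' heq) hlim
  rw [htsum] at h
  linear_combination h / 2

/-- The value at `1` of the `L`-function of an odd function on `ZMod N`. -/
theorem ZMod.LFunction_apply_one_of_odd {N : ℕ} [NeZero N] {Φ : ZMod N → ℂ} (hΦ : Φ.Odd) :
    ZMod.LFunction Φ 1 =
      Real.pi / (2 * N) * ∑ j, Φ j * Complex.cot (Real.pi * (j.val / N : ℝ)) := by
  have h (j : ZMod N) : HurwitzZeta.hurwitzZetaOdd (ZMod.toAddCircle j) 1 =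
      Real.pi / 2 * Complex.cot (Real.pi * (j.val / N : ℝ)) := by
    rcases eq_or_ne j 0 with rfl | hj
    · have h0 := HurwitzZeta.hurwitzZetaOdd_neg 0 1
      rw [neg_zero, self_eq_neg] at h0
      simp [h0, Complex.cot]
    · have hN : (0 : ℝ) < N := by exact_mod_cast NeZero.pos N
      have hv : (0 : ℝ) < j.val := by
        exact_mod_cast Nat.pos_of_ne_zero ((ZMod.val_ne_zero j).2 hj)
      rw [ZMod.toAddCircle_apply]
      exact HurwitzZeta.hurwitzZetaOdd_one_of_mem_Ioo
        ⟨by positivity, (div_lt_one hN).2 (by exact_mod_cast ZMod.val_lt j)⟩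
  simp_rw [ZMod.LFunction_def_odd hΦ, h, Finset.mul_sum, Complex.cpow_neg_one]
  refine Finset.sum_congr rfl fun j _ ↦ ?_
  ring

theorem ZMod.cot_pi_mul_val_div {N : ℕ} [NeZero N] (j : ZMod N) :
    Complex.cot (Real.pi * (j.val / N : ℝ)) =
      (ZMod.stdAddChar j + 1) / (Complex.I * (1 - ZMod.stdAddChar j)) := by
  rw [Complex.cot_pi_eq_exp_ratio]
  have h : ZMod.stdAddChar j = Complex.exp (2 * Real.pi * Complex.I * (j.val / N : ℝ)) := by
    have := ZMod.stdAddChar_coe (N := N) (j.val : ℤ)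
    rw [Int.cast_natCast, ZMod.natCast_zmod_val] at this
    rw [this]
    push_cast
    rw [mul_div_assoc]
  rw [h]

theorem ZMod.isPrimitiveRoot_stdAddChar {p : ℕ} [Fact p.Prime] {c : ZMod p} (hc : c ≠ 0) :
    IsPrimitiveRoot (ZMod.stdAddChar c) p := by
  have h : orderOf (ZMod.stdAddChar c) = p := by
    refine orderOf_eq_prime ?_ fun h ↦ hc ?_
    · rw [← AddChar.map_nsmul_eq_pow]
      simp
    · rw [← AddChar.map_zero_eq_one (ZMod.stdAddChar (N := p))] at h
      exact ZMod.injective_stdAddChar h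
  exact IsPrimitiveRoot.iff_orderOf.2 h

/-- Rational linear relations among the values of a rational function at the powers of a
primitive root of unity do not depend on the primitive root. -/
theorem IsPrimitiveRoot.sum_mul_add_one_div_one_sub_eq_zero {n : ℕ} [NeZero n]
    {ι : Type*} [Fintype ι] {ζ ξ : ℂ} (hζ : IsPrimitiveRoot ζ n) (hξ : IsPrimitiveRoot ξ n)
    (a : ι → ℚ) (m : ι → ℕ)
    (h : ∑ i, (a i : ℂ) * ((ζ ^ m i + 1) / (1 - ζ ^ m i)) = 0) :
    ∑ i, (a i : ℂ) * ((ξ ^ m i + 1) / (1 - ξ ^ m i)) = 0 := by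
  have : IsCyclotomicExtension {n} ℚ (CyclotomicField n ℚ) :=
    CyclotomicField.isCyclotomicExtension n ℚ
  have hz := IsCyclotomicExtension.zeta_spec n ℚ (CyclotomicField n ℚ)
  set z := IsCyclotomicExtension.zeta n ℚ (CyclotomicField n ℚ)
  have hirr := Polynomial.cyclotomic.irreducible_rat (NeZero.pos n)
  have hex {w : ℂ} (hw : IsPrimitiveRoot w n) : ∃ φ : CyclotomicField n ℚ →ₐ[ℚ] ℂ, φ z = w := by
    refine ⟨(hz.embeddingsEquivPrimitiveRoots ℂ hirr).symm
      ⟨w, (mem_primitiveRoots (NeZero.pos n)).2 hw⟩, ?_⟩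
    rw [← hz.embeddingsEquivPrimitiveRoots_apply_coe ℂ hirr, Equiv.apply_symm_apply]
  have hmap (φ : CyclotomicField n ℚ →ₐ[ℚ] ℂ) :
      φ (∑ i, (a i : CyclotomicField n ℚ) * ((z ^ m i + 1) / (1 - z ^ m i))) =
      ∑ i, (a i : ℂ) * ((φ z ^ m i + 1) / (1 - φ z ^ m i)) := by
    simp
  obtain ⟨φ, rfl⟩ := hex hζ
  obtain ⟨ψ, rfl⟩ := hex hξ
  rw [← hmap] at h ⊢
  rw [(map_eq_zero φ).1 h, map_zero]

/-- A relation of cotangent values, twisted by an odd character. -/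
theorem DirichletCharacter.Odd.sum_mul_inv_eq_zero {p : ℕ} [Fact p.Prime] {ι : Type*} [Fintype ι]
    {χ : DirichletCharacter ℂ p} (hχ : χ.Odd) (a : ι → ℚ) (m : ι → ℕ)
    (hm : ∀ i, (m i : ZMod p) ≠ 0)
    (h : ∑ i, (a i : ℂ) * Complex.cot (Real.pi * ((m i : ZMod p).val / p : ℝ)) = 0) :
    ∑ i, (a i : ℂ) * χ (m i : ZMod p)⁻¹ = 0 := by
  let C (j : ZMod p) : ℂ := Complex.cot (Real.pi * (j.val / p : ℝ))
  have hC (c : ZMod p) (i : ι) : C (c * m i) = (ZMod.stdAddChar c ^ m i + 1) /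
      (1 - ZMod.stdAddChar c ^ m i) * Complex.I⁻¹ := by
    rw [← AddChar.map_nsmul_eq_pow, nsmul_eq_mul, mul_comm (m i : ZMod p)]
    simp only [C, ZMod.cot_pi_mul_val_div]
    rw [mul_comm Complex.I, ← div_div, div_eq_mul_inv _ Complex.I]
  have hconj {c : ZMod p} (hc : c ≠ 0) : ∑ i, (a i : ℂ) * C (c * m i) = 0 := by
    have h1 : ∑ i, (a i : ℂ) * C (1 * m i) = 0 := by simpa only [C, one_mul] using h
    simp_rw [hC, ← mul_assoc, ← Finset.sum_mul] at h1 ⊢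
    rw [mul_eq_zero, or_iff_left (inv_ne_zero Complex.I_ne_zero)] at h1
    rw [(ZMod.isPrimitiveRoot_stdAddChar one_ne_zero).sum_mul_add_one_div_one_sub_eq_zero
      (ZMod.isPrimitiveRoot_stdAddChar hc) a m h1, zero_mul]
  have hχ1 : χ ≠ 1 := by
    rintro rfl
    have h1 : (1 : DirichletCharacter ℂ p) (-1) = -1 := hχ
    rw [MulChar.one_apply isUnit_one.neg] at h1
    norm_num at h1
  have hS : ∑ c, χ c * C c ≠ 0 := by
    intro h0
    refine DirichletCharacter.LFunction_apply_one_ne_zero hχ1 ?_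
    rw [DirichletCharacter.LFunction, ZMod.LFunction_apply_one_of_odd hχ.to_fun]
    simp only [C] at h0
    rw [h0, mul_zero]
  have htwist (i : ι) : ∑ c, χ c * C (c * m i) = χ (m i : ZMod p)⁻¹ * ∑ c, χ c * C c := by
    rw [Finset.mul_sum, ← Equiv.sum_comp (Equiv.mulRight₀ (m i : ZMod p) (hm i))
      fun c ↦ χ (m i : ZMod p)⁻¹ * (χ c * C c)]
    refine Finset.sum_congr rfl fun c _ ↦ ?_
    change _ = _ * (χ (c * m i) * C (c * m i))
    rw [← mul_assoc, ← map_mul, mul_comm c, inv_mul_cancel_left₀ (hm i)]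
  refine (mul_eq_zero.1 ?_).resolve_right hS
  calc (∑ i, (a i : ℂ) * χ (m i : ZMod p)⁻¹) * ∑ c, χ c * C c
      = ∑ i, (a i : ℂ) * ∑ c, χ c * C (c * m i) := by
        simp_rw [htwist, Finset.sum_mul, mul_assoc]
    _ = ∑ c, χ c * ∑ i, (a i : ℂ) * C (c * m i) := by
        simp_rw [Finset.mul_sum]
        rw [Finset.sum_comm]
        exact Finset.sum_congr rfl fun _ _ ↦ Finset.sum_congr rfl fun _ _ ↦ mul_left_comm _ _ _
    _ = 0 := Finset.sum_eq_zero fun c _ ↦ by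
        rcases eq_or_ne c 0 with rfl | hc
        · rw [MulChar.map_zero χ, zero_mul]
        · rw [hconj hc, mul_zero]

/-- (Chowla) Let `p` be an odd prime.  Then the values `cot(πk/p)`,
`k = 1, …, (p-1)/2`, are linearly independent over ℚ: any rational linear
combination of them that vanishes has all coefficients zero. -/
theorem cot_linearIndependent (p : ℕ) (hp : p.Prime) (hodd : Odd p)
    (a : Fin ((p - 1) / 2) → ℚ)
    (h : ∑ k : Fin ((p - 1) / 2),
      (a k : ℝ) * Real.cot (Real.pi * (k.1 + 1) / p) = 0) :
    ∀ k, a k = 0 := by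
  intro l
  have : Fact p.Prime := ⟨hp⟩
  let m (k : Fin ((p - 1) / 2)) : ℕ := k.1 + 1
  have hlt (k : Fin ((p - 1) / 2)) : 0 < m k ∧ 2 * m k < p := by
    have := k.2
    simp only [m]
    omega
  have hne (k : Fin ((p - 1) / 2)) : (m k : ZMod p) ≠ 0 := by
    rw [Ne, ZMod.natCast_eq_zero_iff]
    exact Nat.not_dvd_of_pos_of_lt (hlt k).1 (by linarith [hlt k])
  have hrel : ∑ k, (a k : ℂ) * Complex.cot (Real.pi * ((m k : ZMod p).val / p : ℝ)) = 0 := by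
    rw [← Complex.ofReal_zero, ← h, Complex.ofReal_sum]
    refine Finset.sum_congr rfl fun k _ ↦ ?_
    rw [ZMod.val_cast_of_lt (by linarith [hlt k])]
    simp only [m]
    push_cast
    rw [mul_div_assoc]
  have hinj (k : Fin ((p - 1) / 2)) : (m l : ZMod p) = m k ↔ l = k := by
    refine ⟨fun hk ↦ ?_, fun hk ↦ hk ▸ rfl⟩
    rw [ZMod.natCast_eq_natCast_iff'] at hk
    rw [Nat.mod_eq_of_lt (by linarith [hlt l]), Nat.mod_eq_of_lt (by linarith [hlt k])] at hk
    exact Fin.ext (Nat.succ_injective hk)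
  have hneg (k : Fin ((p - 1) / 2)) : -(m l : ZMod p) ≠ m k := by
    rw [Ne, neg_eq_iff_add_eq_zero, ← Nat.cast_add, ZMod.natCast_eq_zero_iff]
    exact Nat.not_dvd_of_pos_of_lt (by linarith [hlt l, hlt k]) (by linarith [hlt l, hlt k])
  have hchar (χ : DirichletCharacter ℂ p) :
      (χ (m l : ZMod p) - χ (-(m l : ZMod p))) * ∑ k, (a k : ℂ) * χ (m k : ZMod p)⁻¹ = 0 := by
    rcases χ.even_or_odd with hχ | hχ
    · rw [hχ.eval_neg, sub_self, zero_mul]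
    · rw [hχ.sum_mul_inv_eq_zero a m hne hrel, mul_zero]
  have horth (x : ZMod p) (k : Fin ((p - 1) / 2)) :
      ∑ χ : DirichletCharacter ℂ p, χ x * χ (m k : ZMod p)⁻¹ =
        if x = m k then (p.totient : ℂ) else 0 := by
    simp_rw [eq_comm (a := x)]
    rw [← DirichletCharacter.sum_char_inv_mul_char_eq ℂ (hne k).isUnit x]
    exact Finset.sum_congr rfl fun _ _ ↦ mul_comm _ _
  have hsum : ∑ k, (a k : ℂ) * ∑ χ : DirichletCharacter ℂ p,
      (χ (m l : ZMod p) - χ (-(m l : ZMod p))) * χ (m k : ZMod p)⁻¹ = 0 := by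
    rw [← Finset.sum_eq_zero fun χ (_ : χ ∈ Finset.univ) ↦ hchar χ]
    simp_rw [Finset.mul_sum]
    rw [Finset.sum_comm]
    exact Finset.sum_congr rfl fun _ _ ↦ Finset.sum_congr rfl fun _ _ ↦ mul_left_comm _ _ _
  simp_rw [sub_mul, Finset.sum_sub_distrib, horth, hinj,
    if_neg (hneg _), sub_zero] at hsum
  simpa [(Nat.totient_pos.2 hp.pos).ne'] using hsum
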